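/- arXiv:0909.5580 — 3 statements merged into one kernel-verified Lean document; each statement's English description precedes it below -/
import Mathlib

section
/- Let λ be a self-dual irreducible element of ℤ[H] (i.e. λ ∼ λ̄). Then the assignment p·A(H)N(H) ↦ e_λ(p) mod 2 is a well-defined surjective group homomorphism Ψ_λ from Q(H)^{sym}/A(H)N(H) onto ℤ/2ℤ. (Proposition 5.1(1), well-definedness and surjectivity.) -/
noncomputable section
open scoped nonZeroDivisors

/-- `H = H₁(Σ_{g,n}) ≅ ℤ^{n-1+2g}`, written as `H_∂ × Ĥ` with `Ĥ` carrying the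
symplectic structure (two `Fin g` blocks). -/
abbrev SurfH (g n : ℕ) : Type := (Fin (n - 1) → ℤ) × ((Fin g → ℤ) × (Fin g → ℤ))

/-- The integral group ring `ℤ[H]`. -/
abbrev GR (g n : ℕ) : Type := AddMonoidAlgebra ℤ (SurfH g n)

instance (g n : ℕ) : IsDomain (GR g n) := NoZeroDivisors.to_isDomain _

/-- The quotient field `Q(H)` of `ℤ[H]`. -/
abbrev QF (g n : ℕ) : Type := FractionRing (GR g n)

/-- The inclusion `ℤ[H] → Q(H)`. -/
abbrev incl (g n : ℕ) : GR g n →+* QF g n := algebraMap (GR g n) (QF g n)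

/-- The standard symplectic form on `Ĥ = ℤ^{2g}`. -/
def symplForm {g : ℕ} (v w : (Fin g → ℤ) × (Fin g → ℤ)) : ℤ :=
  (∑ i, v.1 i * w.2 i) - ∑ i, v.2 i * w.1 i

/-- `Aut*(H)`: automorphisms of `H` fixing `H_∂` pointwise and with block form
`[[I, *], [0, P₀]]`, `P₀ ∈ Sp(2g, ℤ)`. -/
def AutStar (g n : ℕ) : Set (SurfH g n ≃+ SurfH g n) :=
  {φ | (∀ x : Fin (n - 1) → ℤ, φ (x, 0) = (x, 0)) ∧
       ∀ v w : (Fin g → ℤ) × (Fin g → ℤ),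
         symplForm (φ (0, v)).2 (φ (0, w)).2 = symplForm v w}

/-- The ring automorphism of `ℤ[H]` induced by an automorphism of `H`. -/
def ringAut {g n : ℕ} (φ : SurfH g n ≃+ SurfH g n) : GR g n ≃+* GR g n :=
  (AddMonoidAlgebra.domCongr ℤ ℤ φ).toRingEquiv

/-- The field automorphism of `Q(H)` induced by a ring automorphism of `ℤ[H]`. -/
def fieldAut {g n : ℕ} (e : GR g n ≃+* GR g n) : QF g n ≃+* QF g n :=
  IsFractionRing.ringEquivOfRingEquiv e

/-- The involution `p ↦ p̄` of `ℤ[H]`, induced by `h ↦ h⁻¹`. -/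
def barR (g n : ℕ) : GR g n ≃+* GR g n := ringAut (AddEquiv.neg (SurfH g n))

/-- The involution `p ↦ p̄` of `Q(H)`. -/
def barQ (g n : ℕ) : QF g n ≃+* QF g n := fieldAut (barR g n)

/-- `p ≐ q`: `p = ±h·q` for some `h ∈ H`. -/
def doteq {g n : ℕ} (p q : QF g n) : Prop :=
  ∃ (u : ℤˣ) (h : SurfH g n), p = incl g n (AddMonoidAlgebra.single h (u : ℤ)) * q

/-- `p ∼ q`: `p ≐ φ(q)` for some `φ ∈ Aut*(H)`. -/
def sim (g n : ℕ) (p q : QF g n) : Prop :=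
  ∃ φ ∈ AutStar g n, doteq p (fieldAut (ringAut φ) q)

/-- The subgroup `A(H)` of `Q(H)^×` generated by all `±h·p⁻¹·φ(p)`. -/
def AH (g n : ℕ) : Subgroup (QF g n)ˣ :=
  Subgroup.closure {x : (QF g n)ˣ |
    ∃ (u : ℤˣ) (h : SurfH g n) (p : (QF g n)ˣ) (φ : SurfH g n ≃+ SurfH g n),
      φ ∈ AutStar g n ∧
      (x : QF g n) = incl g n (AddMonoidAlgebra.single h (u : ℤ)) * (↑p)⁻¹ *
        fieldAut (ringAut φ) ↑p}

/-- The subgroup `N(H) = {±h·q·q̄}` of `Q(H)^×`. -/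
def NH (g n : ℕ) : Subgroup (QF g n)ˣ :=
  Subgroup.closure {x : (QF g n)ˣ |
    ∃ (u : ℤˣ) (h : SurfH g n) (q : (QF g n)ˣ),
      (x : QF g n) = incl g n (AddMonoidAlgebra.single h (u : ℤ)) * ↑q * barQ g n ↑q}

/-- The involution on `Q(H)^×` as a group homomorphism. -/
def barU (g n : ℕ) : (QF g n)ˣ →* (QF g n)ˣ :=
  Units.map (barQ g n).toRingHom.toMonoidHom

/-- `Q(H)^{sym} = {p : p·A(H) = p̄·A(H)}`. -/
def Qsym (g n : ℕ) : Subgroup (QF g n)ˣ :=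
  (AH g n).comap (barU g n / MonoidHom.id (QF g n)ˣ)

open UniqueFactorizationMonoid in
/-- For irreducible `l`, the number of irreducible factors (with multiplicity) of
`r ∈ ℤ[H]` lying in the `∼`-class of `l`; this is `e_l` on `ℤ[H]`. -/
def eCount (g n : ℕ) [UniqueFactorizationMonoid (GR g n)] (l r : GR g n) : ℕ :=
  Multiset.card (@Multiset.filter _
    (fun m => sim g n (incl g n m) (incl g n l)) (Classical.decPred _) (factors r))

/-- `e_l(p)` for `p ∈ Q(H)^×`, via a choice of fraction representation. -/
def eOrb (g n : ℕ) [UniqueFactorizationMonoid (GR g n)] (l : GR g n) (p : QF g n) : ℤ :=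
  (eCount g n l (IsLocalization.sec (GR g n)⁰ p).1 : ℤ) -
    (eCount g n l ((IsLocalization.sec (GR g n)⁰ p).2 : GR g n) : ℤ)

/-! ### Trivial units of the integral group ring -/

theorem isUnit_single_unit {g n : ℕ} (h : SurfH g n) (u : ℤˣ) :
    IsUnit (AddMonoidAlgebra.single h (u : ℤ) : GR g n) := by
  refine IsUnit.of_mul_eq_one (AddMonoidAlgebra.single (-h) ((u⁻¹ : ℤˣ) : ℤ)) ?_
  rw [AddMonoidAlgebra.single_mul_single, add_neg_cancel, Units.mul_inv]
  rfl

/-- The group ring of a group with two unique sums over a domain has only trivial units. -/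
theorem exists_single_of_mul_eq_one {R G : Type*} [CommRing R] [IsDomain R] [AddCommGroup G]
    [TwoUniqueSums G] {a b : AddMonoidAlgebra R G} (hab : a * b = 1) :
    ∃ (u : Rˣ) (h : G), a = AddMonoidAlgebra.single h (u : R) := by
  have ha : a ≠ 0 := left_ne_zero_of_mul_eq_one hab
  have hb : b ≠ 0 := right_ne_zero_of_mul_eq_one hab
  have hsa : a.coeff.support.Nonempty := by simpa [Finsupp.support_nonempty_iff] using ha
  have hsb : b.coeff.support.Nonempty := by simpa [Finsupp.support_nonempty_iff] using hb
  have hcard : ¬ 1 < a.coeff.support.card * b.coeff.support.card := by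
    intro hc
    obtain ⟨p, hp, q, hq, hne, hup, huq⟩ := TwoUniqueSums.uniqueAdd_of_one_lt_card hc
    rw [Finset.mem_product] at hp hq
    have key : ∀ r : G × G, r.1 ∈ a.coeff.support → r.2 ∈ b.coeff.support →
        UniqueAdd a.coeff.support b.coeff.support r.1 r.2 → r.1 + r.2 = 0 := by
      intro r h1 h2 hr
      have h3 := AddMonoidAlgebra.coeff_mul_add_of_uniqueAdd hr
      by_contra h4
      rw [hab, AddMonoidAlgebra.one_def, AddMonoidAlgebra.coeff_single,
        Finsupp.single_eq_of_ne h4] at h3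
      exact mul_ne_zero (Finsupp.mem_support_iff.mp h1) (Finsupp.mem_support_iff.mp h2) h3.symm
    have hpq := (key p hp.1 hp.2 hup).trans (key q hq.1 hq.2 huq).symm
    have := huq hp.1 hp.2 hpq
    exact hne (Prod.ext this.1 this.2)
  have hca : a.coeff.support.card = 1 := by
    have := Finset.card_pos.mpr hsa
    have := Finset.card_pos.mpr hsb
    nlinarith
  have hcb : b.coeff.support.card = 1 := by
    have := Finset.card_pos.mpr hsb
    rw [hca] at hcard
    omega
  obtain ⟨h, r, -, hr⟩ := Finsupp.card_support_eq_one'.mp hca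
  obtain ⟨k, s, -, hs⟩ := Finsupp.card_support_eq_one'.mp hcb
  have ha' : a = AddMonoidAlgebra.single h r := AddMonoidAlgebra.coeff_injective hr
  have hb' : b = AddMonoidAlgebra.single k s := AddMonoidAlgebra.coeff_injective hs
  rw [ha', hb', AddMonoidAlgebra.single_mul_single, AddMonoidAlgebra.one_def] at hab
  have hrs : r * s = 1 := by
    have h0 := congrArg (fun x => AddMonoidAlgebra.coeff x (h + k)) hab
    simp only [AddMonoidAlgebra.coeff_single, Finsupp.single_eq_same] at h0
    by_cases hk : h + k = 0
    · rw [h0, hk, Finsupp.single_eq_same]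
    · rw [Finsupp.single_eq_of_ne hk] at h0
      rcases mul_eq_zero.mp h0 with h1 | h1
      · exact absurd (by simp [ha', h1]) ha
      · exact absurd (by simp [hb', h1]) hb
  exact ⟨Units.mkOfMulEqOne r s hrs, h, ha'⟩

theorem exists_single_of_isUnit {g n : ℕ} {x : GR g n} (hx : IsUnit x) :
    ∃ (u : ℤˣ) (h : SurfH g n), x = AddMonoidAlgebra.single h (u : ℤ) := by
  obtain ⟨y, hy⟩ := hx.exists_right_inv
  have : TwoUniqueSums (SurfH g n) := UniqueSums.toTwoUniqueSums_of_addGroup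
  exact exists_single_of_mul_eq_one hy

/-! ### The relation `∼` on the group ring -/

theorem fieldAut_incl {g n : ℕ} (e : GR g n ≃+* GR g n) (a : GR g n) :
    fieldAut e (incl g n a) = incl g n (e a) :=
  IsFractionRing.ringEquivOfRingEquiv_algebraMap e a

theorem incl_injective (g n : ℕ) : Function.Injective (incl g n) :=
  IsFractionRing.injective (GR g n) (QF g n)

theorem sim_incl_iff {g n : ℕ} (a b : GR g n) :
    sim g n (incl g n a) (incl g n b) ↔
      ∃ φ ∈ AutStar g n, Associated (ringAut φ b) a := by
  refine exists_congr fun φ => and_congr_right fun _ => ?_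
  rw [doteq, fieldAut_incl]
  constructor
  · rintro ⟨u, h, e⟩
    rw [← map_mul] at e
    rw [incl_injective g n e, mul_comm]
    exact associated_mul_unit_right _ _ (isUnit_single_unit h u)
  · rintro ⟨v, rfl⟩
    obtain ⟨u, h, e⟩ := exists_single_of_isUnit v.isUnit
    exact ⟨u, h, by rw [← e, ← map_mul, mul_comm]⟩

theorem autStar_snd {g n : ℕ} {φ : SurfH g n ≃+ SurfH g n} (hφ : φ ∈ AutStar g n)
    (z : SurfH g n) : (φ z).2 = (φ (0, z.2)).2 := by
  have h : z = (z.1, 0) + (0, z.2) := by simp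
  conv_lhs => rw [h, map_add, hφ.1]
  simp

theorem autStar_trans {g n : ℕ} {φ ψ : SurfH g n ≃+ SurfH g n} (hφ : φ ∈ AutStar g n)
    (hψ : ψ ∈ AutStar g n) : φ.trans ψ ∈ AutStar g n := by
  refine ⟨fun x => by simp only [AddEquiv.trans_apply, hφ.1, hψ.1], fun v w => ?_⟩
  simp only [AddEquiv.trans_apply]
  rw [autStar_snd hψ (φ (0, v)), autStar_snd hψ (φ (0, w)), hψ.2, hφ.2]

theorem autStar_symm {g n : ℕ} {φ : SurfH g n ≃+ SurfH g n} (hφ : φ ∈ AutStar g n) :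
    φ.symm ∈ AutStar g n := by
  refine ⟨fun x => by rw [AddEquiv.symm_apply_eq, hφ.1], fun v w => ?_⟩
  have key : ∀ v, (φ (0, (φ.symm (0, v)).2)).2 = v := fun v => by
    rw [← autStar_snd hφ, AddEquiv.apply_symm_apply]
  rw [← hφ.2, key, key]

theorem ringAut_trans {g n : ℕ} (φ ψ : SurfH g n ≃+ SurfH g n) (a : GR g n) :
    ringAut (φ.trans ψ) a = ringAut ψ (ringAut φ a) :=
  (DFunLike.congr_fun (AddMonoidAlgebra.trans_domCongr_domCongr (R := ℤ) (A := ℤ) φ ψ) a).symm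

theorem ringAut_symm_apply {g n : ℕ} (φ : SurfH g n ≃+ SurfH g n) (a : GR g n) :
    ringAut φ.symm (ringAut φ a) = a :=
  (ringAut φ).symm_apply_apply a

theorem barR_ringAut {g n : ℕ} (φ : SurfH g n ≃+ SurfH g n) (a : GR g n) :
    barR g n (ringAut φ a) = ringAut φ (barR g n a) := by
  rw [barR, ← ringAut_trans, ← ringAut_trans]
  congr 2
  ext x : 1
  simp

theorem barR_barR {g n : ℕ} (a : GR g n) : barR g n (barR g n a) = a :=
  ringAut_symm_apply (AddEquiv.neg (SurfH g n)) a

theorem sim_incl_symm {g n : ℕ} {a b : GR g n} (h : sim g n (incl g n a) (incl g n b)) :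
    sim g n (incl g n b) (incl g n a) := by
  rw [sim_incl_iff] at h ⊢
  obtain ⟨φ, hφ, hab⟩ := h
  refine ⟨φ.symm, autStar_symm hφ, ?_⟩
  have := hab.symm.map (ringAut φ.symm)
  rwa [ringAut_symm_apply] at this

theorem sim_incl_trans {g n : ℕ} {a b c : GR g n} (h : sim g n (incl g n a) (incl g n b))
    (h' : sim g n (incl g n b) (incl g n c)) : sim g n (incl g n a) (incl g n c) := by
  rw [sim_incl_iff] at h h' ⊢
  obtain ⟨φ, hφ, hab⟩ := h
  obtain ⟨ψ, hψ, hbc⟩ := h'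
  refine ⟨ψ.trans φ, autStar_trans hψ hφ, ?_⟩
  rw [ringAut_trans]
  exact (hbc.map (ringAut φ)).trans hab

theorem refl_mem_autStar (g n : ℕ) : AddEquiv.refl (SurfH g n) ∈ AutStar g n :=
  ⟨fun _ => rfl, fun _ _ => rfl⟩

theorem sim_incl_of_associated {g n : ℕ} {a b : GR g n} (h : Associated a b) :
    sim g n (incl g n a) (incl g n b) := by
  rw [sim_incl_iff]
  refine ⟨AddEquiv.refl _, refl_mem_autStar g n, ?_⟩
  have : ringAut (AddEquiv.refl (SurfH g n)) b = b :=
    DFunLike.congr_fun (AddMonoidAlgebra.domCongr_refl (R := ℤ) (A := ℤ)) b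
  rw [this]
  exact h.symm

theorem sim_incl_ringAut {g n : ℕ} {φ : SurfH g n ≃+ SurfH g n} (hφ : φ ∈ AutStar g n)
    (a : GR g n) : sim g n (incl g n (ringAut φ a)) (incl g n a) :=
  (sim_incl_iff _ _).mpr ⟨φ, hφ, Associated.refl _⟩

theorem sim_incl_barR {g n : ℕ} {a b : GR g n} (h : sim g n (incl g n a) (incl g n b)) :
    sim g n (incl g n (barR g n a)) (incl g n (barR g n b)) := by
  rw [sim_incl_iff] at h ⊢
  obtain ⟨φ, hφ, hab⟩ := h
  refine ⟨φ, hφ, ?_⟩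
  rw [← barR_ringAut]
  exact hab.map (barR g n)

theorem sim_incl_congr_left {g n : ℕ} (l : GR g n) {a b : GR g n} (h : sim g n (incl g n a) (incl g n b)) :
    sim g n (incl g n a) (incl g n l) ↔ sim g n (incl g n b) (incl g n l) :=
  ⟨sim_incl_trans (sim_incl_symm h), sim_incl_trans h⟩

theorem exists_fraction {g n : ℕ} {x : QF g n} (hx : x ≠ 0) :
    ∃ a b : GR g n, a ≠ 0 ∧ b ≠ 0 ∧ x * incl g n b = incl g n a := by
  obtain ⟨⟨a, b⟩, h⟩ := IsLocalization.surj (GR g n)⁰ x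
  refine ⟨a, b, ?_, nonZeroDivisors.ne_zero b.2, h⟩
  rintro rfl
  rw [map_zero] at h
  exact mul_ne_zero hx ((map_ne_zero_iff _ (incl_injective g n)).mpr
    (nonZeroDivisors.ne_zero b.2)) h

theorem incl_single_ne_zero {g n : ℕ} (h : SurfH g n) (u : ℤˣ) :
    incl g n (AddMonoidAlgebra.single h (u : ℤ)) ≠ 0 :=
  ((isUnit_single_unit h u).map (incl g n)).ne_zero

/-! ### Counting irreducible factors -/

theorem card_filter_eq_of_rel {α : Type*} {r : α → α → Prop} {p : α → Prop} [DecidablePred p]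
    (hp : ∀ a b, r a b → (p a ↔ p b)) {s t : Multiset α} (h : Multiset.Rel r s t) :
    Multiset.card (s.filter p) = Multiset.card (t.filter p) := by
  induction h with
  | zero => rfl
  | @cons a b s t hab _ ih =>
    by_cases ha : p a
    · simp [ha, (hp a b hab).mp ha, ih]
    · simp [ha, mt (hp a b hab).mpr ha, ih]

section Counting

variable {g n : ℕ} [UniqueFactorizationMonoid (GR g n)] (l : GR g n)

open UniqueFactorizationMonoid

theorem eCount_mul {a b : GR g n} (ha : a ≠ 0) (hb : b ≠ 0) :
    eCount g n l (a * b) = eCount g n l a + eCount g n l b := by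
  classical
  unfold eCount
  rw [card_filter_eq_of_rel (fun x y hxy => sim_incl_congr_left l (sim_incl_of_associated hxy))
    (factors_mul ha hb), Multiset.filter_add, Multiset.card_add]

theorem eCount_of_isUnit {a : GR g n} (ha : IsUnit a) : eCount g n l a = 0 := by
  rw [eCount, factors_of_isUnit ha]
  simp

open scoped Classical in
theorem eCount_of_irreducible {a : GR g n} (ha : Irreducible a) :
    eCount g n l a = if sim g n (incl g n a) (incl g n l) then 1 else 0 := by
  obtain ⟨b, hab, hb⟩ := factors_eq_singleton_of_irreducible ha
  rw [eCount, hb, sim_incl_congr_left l (sim_incl_of_associated hab)]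
  split_ifs with h <;> simp [Multiset.filter_singleton, h]

theorem eCount_ringEquiv (e : GR g n ≃+* GR g n)
    (he : ∀ m, sim g n (incl g n (e m)) (incl g n l) ↔ sim g n (incl g n m) (incl g n l))
    (r : GR g n) : eCount g n l (e r) = eCount g n l r := by
  classical
  induction r using UniqueFactorizationMonoid.induction_on_prime with
  | h₁ => rw [map_zero]
  | h₂ x hx => rw [eCount_of_isUnit l hx, eCount_of_isUnit l (hx.map e)]
  | h₃ a p ha hp ih =>
    have hp' : Irreducible (e p) := (MulEquiv.irreducible_iff e.toMulEquiv).mpr hp.irreducible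
    rw [map_mul, eCount_mul l hp'.ne_zero ((map_ne_zero_iff e e.injective).mpr ha),
      eCount_mul l hp.ne_zero ha, ih, eCount_of_irreducible l hp',
      eCount_of_irreducible l hp.irreducible]
    simp only [he]

theorem eCount_ringAut {φ : SurfH g n ≃+ SurfH g n} (hφ : φ ∈ AutStar g n) (r : GR g n) :
    eCount g n l (ringAut φ r) = eCount g n l r :=
  eCount_ringEquiv l _ (fun m => sim_incl_congr_left l (sim_incl_ringAut hφ m)) r

theorem eCount_barR (hsd : sim g n (incl g n l) (incl g n (barR g n l))) (r : GR g n) :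
    eCount g n l (barR g n r) = eCount g n l r := by
  refine eCount_ringEquiv l _ (fun m => ⟨fun h => ?_, fun h => ?_⟩) r
  · have := sim_incl_barR h
    rw [barR_barR] at this
    exact sim_incl_trans this (sim_incl_symm hsd)
  · exact sim_incl_trans (sim_incl_barR h) (sim_incl_symm hsd)

/-! ### The exponent `e_λ` on the quotient field -/

theorem eOrb_eq {x : QF g n} {a b : GR g n} (ha : a ≠ 0) (hb : b ≠ 0)
    (hx : x * incl g n b = incl g n a) :
    eOrb g n l x = (eCount g n l a : ℤ) - eCount g n l b := by
  have hs := IsLocalization.sec_spec (GR g n)⁰ x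
  have hs2 : ((IsLocalization.sec (GR g n)⁰ x).2 : GR g n) ≠ 0 :=
    nonZeroDivisors.ne_zero (IsLocalization.sec (GR g n)⁰ x).2.2
  unfold eOrb
  generalize (IsLocalization.sec (GR g n)⁰ x).1 = c at *
  generalize ((IsLocalization.sec (GR g n)⁰ x).2 : GR g n) = d at *
  have hcd : c * b = a * d := by
    apply incl_injective g n
    rw [map_mul, map_mul, ← hx, ← hs]
    ring
  have hc : c ≠ 0 := by
    rintro rfl
    rw [zero_mul] at hcd
    exact mul_ne_zero ha hs2 hcd.symm
  have h := congrArg (eCount g n l) hcd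
  rw [eCount_mul l hc hb, eCount_mul l ha hs2] at h
  omega

theorem eOrb_mul {x y : QF g n} (hx : x ≠ 0) (hy : y ≠ 0) :
    eOrb g n l (x * y) = eOrb g n l x + eOrb g n l y := by
  obtain ⟨a, b, ha, hb, h⟩ := exists_fraction hx
  obtain ⟨c, d, hc, hd, h'⟩ := exists_fraction hy
  rw [eOrb_eq l ha hb h, eOrb_eq l hc hd h', eOrb_eq l (mul_ne_zero ha hc) (mul_ne_zero hb hd)
    (by rw [map_mul, map_mul, ← h, ← h']; ring), eCount_mul l ha hc, eCount_mul l hb hd]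
  push_cast
  ring

theorem eOrb_incl {a : GR g n} (ha : a ≠ 0) : eOrb g n l (incl g n a) = eCount g n l a := by
  rw [eOrb_eq l ha one_ne_zero (by rw [map_one, mul_one]), eCount_of_isUnit l isUnit_one]
  simp

theorem eOrb_inv {x : QF g n} (hx : x ≠ 0) : eOrb g n l x⁻¹ = -eOrb g n l x := by
  have h := eOrb_mul l hx (inv_ne_zero hx)
  have h1 := eOrb_incl l (one_ne_zero (α := GR g n))
  rw [eCount_of_isUnit l isUnit_one, map_one] at h1
  rw [mul_inv_cancel₀ hx, h1] at h
  push_cast at h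
  omega

theorem eOrb_fieldAut (e : GR g n ≃+* GR g n) (he : ∀ r, eCount g n l (e r) = eCount g n l r)
    {x : QF g n} (hx : x ≠ 0) : eOrb g n l (fieldAut e x) = eOrb g n l x := by
  obtain ⟨a, b, ha, hb, h⟩ := exists_fraction hx
  rw [eOrb_eq l ha hb h, eOrb_eq l ((map_ne_zero_iff e e.injective).mpr ha)
    ((map_ne_zero_iff e e.injective).mpr hb)
    (by rw [← fieldAut_incl, ← fieldAut_incl, ← map_mul, h]), he, he]

theorem eOrb_single_mul (h : SurfH g n) (u : ℤˣ) {x : QF g n} (hx : x ≠ 0) :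
    eOrb g n l (incl g n (AddMonoidAlgebra.single h (u : ℤ)) * x) = eOrb g n l x := by
  rw [eOrb_mul l (incl_single_ne_zero h u) hx, eOrb_incl l (isUnit_single_unit h u).ne_zero,
    eCount_of_isUnit l (isUnit_single_unit h u)]
  simp

/-- `p ↦ e_λ(p) mod 2` as a homomorphism on `Q(H)^×`. -/
def eOrbMod : (QF g n)ˣ →* Multiplicative (ZMod 2) :=
  MonoidHom.mk' (fun x => Multiplicative.ofAdd ((eOrb g n l (x : QF g n) : ℤ) : ZMod 2))
    fun x y => by
      rw [Units.val_mul, eOrb_mul l x.ne_zero y.ne_zero, Int.cast_add, ofAdd_add]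

theorem AH_le_ker_eOrbMod : AH g n ≤ (eOrbMod l).ker := by
  refine (Subgroup.closure_le _).mpr ?_
  rintro x ⟨u, h, p, φ, hφ, hx⟩
  have hp := p.ne_zero
  have h0 : fieldAut (ringAut φ) (p : QF g n) ≠ 0 :=
    (map_ne_zero_iff _ (RingEquiv.injective _)).mpr hp
  have : eOrb g n l (x : QF g n) = 0 := by
    rw [hx, mul_assoc, eOrb_single_mul l h u (mul_ne_zero (inv_ne_zero hp) h0),
      eOrb_mul l (inv_ne_zero hp) h0, eOrb_inv l hp,
      eOrb_fieldAut l _ (eCount_ringAut l hφ) hp, neg_add_cancel]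
  rw [SetLike.mem_coe, MonoidHom.mem_ker]
  simp [eOrbMod, this]

theorem NH_le_ker_eOrbMod (hsd : sim g n (incl g n l) (incl g n (barR g n l))) :
    NH g n ≤ (eOrbMod l).ker := by
  refine (Subgroup.closure_le _).mpr ?_
  rintro x ⟨u, h, q, hx⟩
  have hq := q.ne_zero
  have h0 : barQ g n (q : QF g n) ≠ 0 := (map_ne_zero_iff _ (RingEquiv.injective _)).mpr hq
  have : eOrb g n l (x : QF g n) = eOrb g n l (q : QF g n) + eOrb g n l (q : QF g n) := by
    rw [hx, mul_assoc, eOrb_single_mul l h u (mul_ne_zero hq h0), eOrb_mul l hq h0, barQ,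
      eOrb_fieldAut l _ (eCount_barR l hsd) hq]
  rw [SetLike.mem_coe, MonoidHom.mem_ker]
  simp [eOrbMod, this, CharTwo.add_self_eq_zero]

end Counting

/-- A nonzero self-dual element of `ℤ[H]` lies in `Q(H)^{sym}`. -/
theorem mem_Qsym_of_sim_barR {g n : ℕ} {l : GR g n} {x : (QF g n)ˣ}
    (hx : (x : QF g n) = incl g n l) (hsd : sim g n (incl g n l) (incl g n (barR g n l))) :
    x ∈ Qsym g n := by
  obtain ⟨φ, hφ, u, h, e⟩ := hsd
  have hb : ((barU g n x : (QF g n)ˣ) : QF g n) = incl g n (barR g n l) := by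
    rw [← fieldAut_incl, ← hx]
    rfl
  rw [Qsym, Subgroup.mem_comap, ← inv_mem_iff]
  refine Subgroup.subset_closure ⟨u, h, barU g n x, φ, hφ, ?_⟩
  rw [MonoidHom.div_apply, inv_div, MonoidHom.id_apply, Units.val_div_eq_div_val, hb, hx,
    div_eq_mul_inv, mul_right_comm, ← e]

/-- **Proposition 5.1 (1), well-definedness and surjectivity of `Ψ_λ`.**
If `λ ∈ ℤ[H]` is a self-dual irreducible element, then `p·A(H)N(H) ↦ e_λ(p) mod 2`
is a well-defined surjective group homomorphism `Q(H)^{sym}/A(H)N(H) → ℤ/2`. -/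
theorem torsion_psi_lambda_well_defined_surjective
    (g n : ℕ) (hH : 1 ≤ (n - 1) + 2 * g)
    [UniqueFactorizationMonoid (GR g n)]
    (l : GR g n) (hirr : Irreducible l)
    (hsd : sim g n (incl g n l) (incl g n (barR g n l))) :
    ∃ Ψ : ↥(Qsym g n) ⧸ ((AH g n ⊔ NH g n).subgroupOf (Qsym g n)) →*
        Multiplicative (ZMod 2),
      Function.Surjective Ψ ∧
      ∀ p : ↥(Qsym g n),
        Ψ (QuotientGroup.mk p) =
          Multiplicative.ofAdd ((eOrb g n l ((p : (QF g n)ˣ) : QF g n) : ZMod 2)) := by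
  have hker : (AH g n ⊔ NH g n).subgroupOf (Qsym g n) ≤
      ((eOrbMod l).comp (Qsym g n).subtype).ker := fun p hp =>
    sup_le (AH_le_ker_eOrbMod l) (NH_le_ker_eOrbMod l hsd) (Subgroup.mem_subgroupOf.mp hp)
  refine ⟨QuotientGroup.lift _ ((eOrbMod l).comp (Qsym g n).subtype) hker, ?_, fun p => rfl⟩
  have hl : incl g n l ≠ 0 := (map_ne_zero_iff _ (incl_injective g n)).mpr hirr.ne_zero
  let x : (QF g n)ˣ := Units.mk0 (incl g n l) hl
  have hx : eOrbMod l x = Multiplicative.ofAdd 1 := by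
    have : eOrb g n l (x : QF g n) = 1 := by
      rw [Units.val_mk0, eOrb_incl l hirr.ne_zero, eCount_of_irreducible l hirr,
        if_pos (sim_incl_of_associated (Associated.refl l)), Nat.cast_one]
    simp [eOrbMod, this]
  intro z
  have hz : z = Multiplicative.ofAdd 0 ∨ z = Multiplicative.ofAdd 1 := by
    revert z
    decide
  rcases hz with rfl | rfl
  · exact ⟨1, map_one _⟩
  · exact ⟨QuotientGroup.mk ⟨x, mem_Qsym_of_sim_barR rfl hsd⟩, hx⟩
end
end

section
/- Suppose n ≤ 1 and g ≥ 1, so that H = ℤ^{2g} and Aut*(H) = Sp(2g,ℤ). Then the quotient group Q(H)^×/A(H)N(H) is isomorphic to a direct sum of countably infinitely many copies of ℤ/2ℤ. (Theorem 5.2, the case of surfaces with at most one boundary component.) -/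
noncomputable section
open scoped nonZeroDivisors

section ConstantPrimes

variable {M : Type*}

theorem coeff_natCast_mul [AddCommMonoid M] (k : ℕ) (f : AddMonoidAlgebra ℤ M) (m : M) :
    ((k : AddMonoidAlgebra ℤ M) * f).coeff m = k * f.coeff m := by
  rw [← nsmul_eq_mul, AddMonoidAlgebra.coeff_smul, Finsupp.smul_apply, nsmul_eq_mul]

theorem coeff_natCast_zero [AddCommMonoid M] (k : ℕ) :
    (k : AddMonoidAlgebra ℤ M).coeff 0 = k := by
  rw [← mul_one (k : AddMonoidAlgebra ℤ M), coeff_natCast_mul]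
  simp [AddMonoidAlgebra.one_def]

theorem natCast_dvd_iff_dvd_coeff [AddCommMonoid M] (k : ℕ) (f : AddMonoidAlgebra ℤ M) :
    (k : AddMonoidAlgebra ℤ M) ∣ f ↔ ∀ m, (k : ℤ) ∣ f.coeff m := by
  constructor
  · rintro ⟨q, rfl⟩ m
    exact ⟨q.coeff m, coeff_natCast_mul k q m⟩
  · intro h
    refine ⟨.ofCoeff (f.coeff.mapRange (· / (k : ℤ)) (by simp)), ?_⟩
    ext m
    simp [coeff_natCast_mul, Int.mul_ediv_cancel' (h m)]

theorem prime_natCast_addMonoidAlgebra [AddCommMonoid M] [UniqueSums M] {p : ℕ} (hp : p.Prime) :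
    Prime (p : AddMonoidAlgebra ℤ M) := by
  have : Fact p.Prime := ⟨hp⟩
  have key (f : AddMonoidAlgebra ℤ M) : (p : AddMonoidAlgebra ℤ M) ∣ f ↔
      AddMonoidAlgebra.mapRingHom M (Int.castRingHom (ZMod p)) f = 0 := by
    rw [natCast_dvd_iff_dvd_coeff, AddMonoidAlgebra.ext_iff, Finsupp.ext_iff]
    simp [ZMod.intCast_zmod_eq_zero_iff_dvd]
  refine ⟨?_, fun hu ↦ ?_, fun a b h ↦ ?_⟩
  · intro h0
    have h := coeff_natCast_zero (M := M) p
    rw [h0, AddMonoidAlgebra.coeff_zero, Finsupp.zero_apply] at h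
    exact hp.ne_zero (by exact_mod_cast h.symm)
  · have h := (key 1).1 hu.dvd
    rw [map_one] at h
    exact one_ne_zero h
  · simp only [key, map_mul, mul_eq_zero] at h ⊢
    exact h

theorem finiteMultiplicity_natCast_addMonoidAlgebra [AddCommMonoid M] {p : ℕ} (hp : p.Prime)
    {f : AddMonoidAlgebra ℤ M} (hf : f ≠ 0) :
    FiniteMultiplicity (p : AddMonoidAlgebra ℤ M) f := by
  obtain ⟨m, hm⟩ : ∃ m, f.coeff m ≠ 0 := by
    by_contra! h
    exact hf (by ext m; simpa using h m)
  obtain ⟨n, hn⟩ := FiniteMultiplicity.of_prime_left (Nat.prime_iff_prime_int.1 hp) hm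
  refine ⟨n, fun h ↦ hn ?_⟩
  rw [← Nat.cast_pow, natCast_dvd_iff_dvd_coeff] at h
  exact_mod_cast h m

end ConstantPrimes

/-- The sign `(-1) ^ v_p(f)` of the `p`-adic content valuation of `f ∈ ℤ[H]`. -/
def contentSign (g n : ℕ) {p : ℕ} (hp : p.Prime) : GR g n →* ℤ where
  toFun f := open Classical in if f = 0 then 0 else (-1) ^ multiplicity (p : GR g n) f
  map_one' := by
    rw [if_neg one_ne_zero,
      multiplicity_of_isUnit_right (prime_natCast_addMonoidAlgebra hp).not_isUnit isUnit_one, pow_zero]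
  map_mul' a b := by
    by_cases ha : a = 0
    · simp [ha]
    by_cases hb : b = 0
    · simp [hb]
    have hab := mul_ne_zero ha hb
    rw [if_neg ha, if_neg hb, if_neg hab, ← pow_add,
      multiplicity_mul (prime_natCast_addMonoidAlgebra hp)
        (finiteMultiplicity_natCast_addMonoidAlgebra hp hab)]

variable {g n p : ℕ}

theorem contentSign_apply (hp : p.Prime) {f : GR g n} (hf : f ≠ 0) :
    contentSign g n hp f = (-1) ^ multiplicity (p : GR g n) f :=
  if_neg hf

theorem isUnit_contentSign (hp : p.Prime) {f : GR g n} (hf : f ≠ 0) :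
    IsUnit (contentSign g n hp f) := by
  rw [contentSign_apply hp hf]
  exact isUnit_one.neg.pow _

theorem contentSign_ringEquiv (hp : p.Prime) (e : GR g n ≃+* GR g n) (f : GR g n) :
    contentSign g n hp (e f) = contentSign g n hp f := by
  by_cases hf : f = 0
  · simp [hf]
  · have h := multiplicity_map_eq e (a := (p : GR g n)) (b := f)
    rw [map_natCast] at h
    rw [contentSign_apply hp hf, contentSign_apply hp (by simpa using hf), h]

theorem contentSign_of_isUnit (hp : p.Prime) {f : GR g n} (hf : IsUnit f) :
    contentSign g n hp f = 1 := by
  rw [contentSign_apply hp hf.ne_zero,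
    multiplicity_of_isUnit_right (prime_natCast_addMonoidAlgebra hp).not_isUnit hf, pow_zero]

/-- The extension of `contentSign` to the fraction field `Q(H)`. -/
def fracSign (g n : ℕ) {p : ℕ} (hp : p.Prime) : QF g n →* ℤ :=
  (IsLocalization.toLocalizationMap (GR g n)⁰ (QF g n)).lift (g := contentSign g n hp)
    fun y ↦ isUnit_contentSign hp (nonZeroDivisors.coe_ne_zero y)

theorem fracSign_incl (hp : p.Prime) (f : GR g n) :
    fracSign g n hp (incl g n f) = contentSign g n hp f :=
  Submonoid.LocalizationMap.lift_eq _ _ f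

theorem fracSign_fieldAut (hp : p.Prime) (e : GR g n ≃+* GR g n) (x : QF g n) :
    fracSign g n hp (fieldAut e x) = fracSign g n hp x := by
  have h : (fracSign g n hp).comp (fieldAut e : QF g n →* QF g n) = fracSign g n hp := by
    refine (IsLocalization.toLocalizationMap (GR g n)⁰ (QF g n)).epic_of_localizationMap
      (MonoidHom.ext fun f ↦ ?_)
    change fracSign g n hp (fieldAut e (incl g n f)) = fracSign g n hp (incl g n f)
    rw [fieldAut, IsFractionRing.ringEquivOfRingEquiv_algebraMap, fracSign_incl, fracSign_incl,
      contentSign_ringEquiv]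
  exact DFunLike.congr_fun h x

theorem isUnit_single (u : ℤˣ) (h : SurfH g n) :
    IsUnit (AddMonoidAlgebra.single h (u : ℤ) : GR g n) := by
  refine IsUnit.of_mul_eq_one (AddMonoidAlgebra.single (-h) ((u⁻¹ : ℤˣ) : ℤ)) ?_
  rw [AddMonoidAlgebra.single_mul_single]
  simp [AddMonoidAlgebra.one_def]

/-- `fracSign` as a character of `Q(H)^×`. -/
def unitSign (g n : ℕ) {p : ℕ} (hp : p.Prime) : (QF g n)ˣ →* ℤˣ :=
  Units.map (fracSign g n hp)

theorem sup_le_ker_unitSign (hp : p.Prime) :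
    AH g n ⊔ NH g n ≤ (unitSign g n hp).ker := by
  refine sup_le ((Subgroup.closure_le _).2 ?_) ((Subgroup.closure_le _).2 ?_)
  · rintro x ⟨u, h, q, φ, -, hx⟩
    refine Units.ext ?_
    change fracSign g n hp x = 1
    rw [hx, map_mul, map_mul, fracSign_fieldAut, fracSign_incl,
      contentSign_of_isUnit hp (isUnit_single u h), one_mul, ← map_mul,
      inv_mul_cancel₀ q.ne_zero, map_one]
  · rintro x ⟨u, h, q, hx⟩
    refine Units.ext ?_
    change fracSign g n hp x = 1
    rw [hx, map_mul, map_mul, barQ, fracSign_fieldAut, fracSign_incl,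
      contentSign_of_isUnit hp (isUnit_single u h), one_mul]
    exact Int.units_coe_mul_self (unitSign g n hp q)

/-- A rational prime as an element of `Q(H)^×`. -/
def primeUnit (g n : ℕ) (p : Nat.Primes) : (QF g n)ˣ :=
  Units.mk0 (incl g n (p : ℕ)) <| by
    simpa using fun h ↦ (prime_natCast_addMonoidAlgebra (M := SurfH g n) p.2).ne_zero
      (FaithfulSMul.algebraMap_injective (GR g n) (QF g n) (by simpa using h))

theorem unitSign_primeUnit (p q : Nat.Primes) :
    unitSign g n p.2 (primeUnit g n q) = 1 ↔ p ≠ q := by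
  have hp : Prime ((p : ℕ) : GR g n) := prime_natCast_addMonoidAlgebra p.2
  have hq : Prime ((q : ℕ) : GR g n) := prime_natCast_addMonoidAlgebra q.2
  rw [Units.ext_iff]
  change fracSign g n p.2 (incl g n (q : ℕ)) = 1 ↔ _
  rw [fracSign_incl, contentSign_apply _ hq.ne_zero]
  by_cases h : p = q
  · subst h
    rw [multiplicity_self]
    simp
  · have : ¬ ((p : ℕ) : GR g n) ∣ ((q : ℕ) : GR g n) := by
      intro hd
      rw [natCast_dvd_iff_dvd_coeff] at hd
      have h0 := hd 0
      rw [coeff_natCast_zero] at h0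
      exact h (Subtype.ext ((Nat.prime_dvd_prime_iff_eq p.2 q.2).1 (by exact_mod_cast h0)))
    rw [multiplicity_eq_zero.2 this]
    simp [h]

instance infinite_quotient : Infinite ((QF g n)ˣ ⧸ (AH g n ⊔ NH g n)) := by
  refine Infinite.of_injective (fun p : Nat.Primes ↦ (primeUnit g n p : _ ⧸ (AH g n ⊔ NH g n)))
    fun p q hpq ↦ ?_
  by_contra hne
  have h := sup_le_ker_unitSign p.2 (QuotientGroup.eq.1 hpq)
  rw [MonoidHom.mem_ker, map_mul, (unitSign_primeUnit p q).2 hne, mul_one, map_inv,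
    inv_eq_one, unitSign_primeUnit] at h
  exact h rfl

instance countable_quotient : Countable ((QF g n)ˣ ⧸ (AH g n ⊔ NH g n)) := by
  have : Countable (GR g n) :=
    Function.Injective.countable (f := AddMonoidAlgebra.coeff)
      fun a b h ↦ AddMonoidAlgebra.ext h
  have : Countable (QF g n) := by
    rw [← Cardinal.mk_le_aleph0_iff]
    exact (IsLocalization.cardinalMk_le (GR g n)⁰).trans Cardinal.mk_le_aleph0
  have : Countable (QF g n)ˣ := Units.val_injective.countable
  exact Quotient.countable

theorem neg_mem_AutStar (hn : n ≤ 1) : AddEquiv.neg (SurfH g n) ∈ AutStar g n := by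
  have : IsEmpty (Fin (n - 1)) := by
    rw [Nat.sub_eq_zero_of_le hn]
    infer_instance
  refine ⟨fun x ↦ ?_, fun v w ↦ ?_⟩
  · exact Prod.ext (Subsingleton.elim _ _) neg_zero
  · simp [symplForm]

/-- Since `-1 ∈ Aut*(H)`, the element `x * x̄` agrees with `x ^ 2` modulo `A(H)`. -/
theorem sq_mem_sup (hn : n ≤ 1) (x : (QF g n)ˣ) : x ^ 2 ∈ AH g n ⊔ NH g n := by
  have hone : incl g n (AddMonoidAlgebra.single 0 ((1 : ℤˣ) : ℤ)) = 1 := by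
    rw [Units.val_one, ← AddMonoidAlgebra.one_def, map_one]
  have hA : x⁻¹ * barU g n x ∈ AH g n := by
    refine Subgroup.subset_closure ⟨1, 0, x, _, neg_mem_AutStar hn, ?_⟩
    rw [hone, one_mul, Units.val_mul, Units.val_inv_eq_inv_val]
    rfl
  have hN : x * barU g n x ∈ NH g n := by
    refine Subgroup.subset_closure ⟨1, 0, x, ?_⟩
    rw [hone, one_mul, Units.val_mul]
    rfl
  have h : x ^ 2 = (x⁻¹ * barU g n x)⁻¹ * (x * barU g n x) := by
    rw [mul_inv, inv_inv, mul_mul_mul_comm, inv_mul_cancel, mul_one, sq]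
  rw [h]
  exact mul_mem (inv_mem (Subgroup.mem_sup_left hA)) (Subgroup.mem_sup_right hN)

/-- A countably infinite elementary abelian `2`-group is a direct sum of `ℕ` copies of `ℤ/2`. -/
theorem nonempty_mulEquiv_of_sq_eq_one (G : Type*) [CommGroup G] [Countable G] [Infinite G]
    (hG : ∀ x : G, x ^ 2 = 1) : Nonempty (G ≃* Multiplicative (ℕ →₀ ZMod 2)) := by
  let : Module (ZMod 2) (Additive G) :=
    AddCommGroup.zmodModule fun x ↦ hG x.toMul
  let b := Module.Free.chooseBasis (ZMod 2) (Additive G)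
  have : Infinite (Additive G) := ‹Infinite G›
  have : Countable (Additive G) := ‹Countable G›
  have : Countable (Module.Free.ChooseBasisIndex (ZMod 2) (Additive G)) :=
    b.injective.countable
  have : Infinite (Module.Free.ChooseBasisIndex (ZMod 2) (Additive G)) := by
    rw [← not_finite_iff_infinite]
    intro _
    have : Finite (Additive G) := by
      have : Finite (Module.Free.ChooseBasisIndex (ZMod 2) (Additive G) → ZMod 2) := inferInstance
      exact Finite.of_equiv _ b.equivFun.toEquiv.symm
    exact not_finite (Additive G)
  obtain ⟨e⟩ : Nonempty (Module.Free.ChooseBasisIndex (ZMod 2) (Additive G) ≃ ℕ) :=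
    nonempty_equiv_of_countable
  exact ⟨AddEquiv.toMultiplicativeRight (b.reindex e).repr.toAddEquiv⟩

/-- **Theorem 5.2, case of at most one boundary component.**
For `n ≤ 1` and `g ≥ 1` (so `H = ℤ^{2g}` and `Aut*(H) = Sp(2g,ℤ)`), the group
`Q(H)^×/A(H)N(H)` is isomorphic to a direct sum of countably infinitely many
copies of `ℤ/2`. -/
theorem torsion_group_iso_small_case (g n : ℕ) (hn : n ≤ 1) (hg : 1 ≤ g) :
    Nonempty (((QF g n)ˣ ⧸ (AH g n ⊔ NH g n)) ≃* Multiplicative (ℕ →₀ ZMod 2)) := by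
  refine nonempty_mulEquiv_of_sq_eq_one ((QF g n)ˣ ⧸ (AH g n ⊔ NH g n)) fun x ↦ ?_
  induction x using QuotientGroup.induction_on with
  | H x => exact (QuotientGroup.eq_one_iff _).2 (sq_mem_sup hn x)
end
end

section
/- There exist sequences of integers r_i, s_i > 0 and t_i < 0 (i ∈ ℕ) and irreducible elements p_i ∈ ℤ[a^{±1}, b^{±1}] such that: (1) s_i² + 1 = (r_i + s_i)(t_i + s_i) for every i; (2) p_i ≐̸ p̄_i for every i; and (3) p_i divides T(r_j, s_j, t_j) in ℤ[a^{±1}, b^{±1}] if and only if i = j. (Proposition 7.2.) -/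
noncomputable section

/-- The Laurent polynomial ring `ℤ[a^{±1}, b^{±1}]`, i.e. the group ring of `ℤ²`. -/
abbrev LP : Type := AddMonoidAlgebra ℤ (ℤ × ℤ)

/-- The variable `a`. -/
def va : LP := AddMonoidAlgebra.single (1, 0) 1

/-- The variable `b`. -/
def vb : LP := AddMonoidAlgebra.single (0, 1) 1

/-- The inverse variable `b⁻¹`. -/
def vbinv : LP := AddMonoidAlgebra.single (0, -1) 1

/-- The torsion `T(r,s,t)` of the pretzel-link homology cylinder `M(r,s,t)`,
where `t = -x < 0`:
`T = (Σa^i)(Σb^j) + a^r(Σb^j)(Σ(ab⁻¹)^k) − a·b^{x−1}(Σa^i)(Σ(ab⁻¹)^k)`. -/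
def TT (r s x : ℕ) : LP :=
  (∑ i ∈ Finset.range r, va ^ i) * (∑ j ∈ Finset.range x, vb ^ j) +
    va ^ r * (∑ j ∈ Finset.range x, vb ^ j) *
      (∑ k ∈ Finset.range s, (va * vbinv) ^ k) -
    va * vb ^ (x - 1) * (∑ i ∈ Finset.range r, va ^ i) *
      (∑ k ∈ Finset.range s, (va * vbinv) ^ k)

/-- The involution `p ↦ p̄` induced by `a ↦ a⁻¹`, `b ↦ b⁻¹`. -/
def barLP : LP ≃+* LP :=
  (AddMonoidAlgebra.domCongr ℤ ℤ (AddEquiv.neg (ℤ × ℤ))).toRingEquiv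

/-- `p ≐ q`: `p = ±a^m b^n·q`. -/
def doteqLP (p q : LP) : Prop :=
  ∃ (u : ℤˣ) (h : ℤ × ℤ), p = AddMonoidAlgebra.single h (u : ℤ) * q

open HahnSeries in
/-- A power series with nonzero constant coefficient has that coefficient as its leading
coefficient. -/
theorem leadingCoeff_ofPowerSeries {R : Type*} [Semiring R] {f : PowerSeries R}
    (hf : PowerSeries.constantCoeff f ≠ 0) :
    (ofPowerSeries ℤ R f).leadingCoeff = PowerSeries.constantCoeff f := by
  have h0 : (ofPowerSeries ℤ R f).coeff 0 = PowerSeries.constantCoeff f := by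
    simpa using ofPowerSeries_apply_coeff (Γ := ℤ) f 0
  have hle : (ofPowerSeries ℤ R f).order ≤ 0 :=
    order_le_of_coeff_ne_zero (by rwa [h0])
  have hne : (ofPowerSeries ℤ R f) ≠ 0 := by
    intro h
    rw [h, coeff_zero] at h0
    exact hf h0.symm
  have hge : 0 ≤ (ofPowerSeries ℤ R f).order := by
    by_contra hlt
    refine hne (coeff_order_eq_zero.mp ?_)
    rw [ofPowerSeries_apply]
    refine embDomain_of_notMem_range ?_
    rintro ⟨n, hn⟩
    rw [← ofPowerSeries_apply] at hn
    apply hlt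
    rw [← hn]
    exact Int.natCast_nonneg n
  rw [leadingCoeff_eq, le_antisymm hle hge, h0]

open LaurentPolynomial in
/-- The embedding of `ℤ[a^{±1}, b^{±1}]` into Laurent series in `a` over `ℤ[b^{±1}]`. -/
def toSeries : LP →+* HahnSeries ℤ (LaurentPolynomial ℤ) :=
  AddMonoidAlgebra.liftNCRingHom (Int.castRingHom _)
    { toFun := fun g => HahnSeries.single g.toAdd.1 (T g.toAdd.2)
      map_one' := rfl
      map_mul' := fun g h => by
        rw [HahnSeries.single_mul_single, ← T_add]; rfl }
    fun _ _ => Commute.all _ _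

theorem toSeries_single (m n : ℤ) :
    toSeries (AddMonoidAlgebra.single (m, n) 1) =
      HahnSeries.single m (LaurentPolynomial.T n) :=
  (AddMonoidAlgebra.liftNC_single _ _ _ _).trans <|
    (congrArg (· * _) (map_one (Int.castRingHom _))).trans (one_mul _)

/-- The lowest coefficient with respect to `a`, evaluated at `b = z`. -/
def lowestEval (z : ℂˣ) : LP →*₀ ℂ where
  toFun f := LaurentPolynomial.eval₂ (Int.castRingHom ℂ) z (toSeries f).leadingCoeff
  map_zero' := by simp
  map_one' := by simp
  map_mul' f g := by simp

theorem lowestEval_of_toSeries_eq {z : ℂˣ} {f : LP} {F : PowerSeries (LaurentPolynomial ℤ)}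
    (h : toSeries f = HahnSeries.ofPowerSeries ℤ _ F) (hF : PowerSeries.constantCoeff F ≠ 0) :
    lowestEval z f =
      LaurentPolynomial.eval₂ (Int.castRingHom ℂ) z (PowerSeries.constantCoeff F) := by
  change LaurentPolynomial.eval₂ _ _ _ = _
  rw [h, leadingCoeff_ofPowerSeries hF]

section

open HahnSeries LaurentPolynomial

theorem toSeries_va : toSeries va = ofPowerSeries ℤ _ PowerSeries.X := by
  simp [va, toSeries_single]

theorem toSeries_vb : toSeries vb = ofPowerSeries ℤ _ (PowerSeries.C (T 1)) := by
  rw [vb, toSeries_single, ofPowerSeries_C]; rfl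

theorem toSeries_vbinv : toSeries vbinv = ofPowerSeries ℤ _ (PowerSeries.C (T (-1))) := by
  rw [vbinv, toSeries_single, ofPowerSeries_C]; rfl

end

theorem lowestEval_TT {r x : ℕ} (hr : 0 < r) (hx : 0 < x) (s : ℕ) (z : ℂˣ) :
    lowestEval z (TT r s x) = ∑ j ∈ Finset.range x, (z : ℂ) ^ j := by
  let A : PowerSeries (LaurentPolynomial ℤ) := PowerSeries.X
  let B : PowerSeries (LaurentPolynomial ℤ) := PowerSeries.C (LaurentPolynomial.T 1)
  let B' : PowerSeries (LaurentPolynomial ℤ) := PowerSeries.C (LaurentPolynomial.T (-1))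
  let F := (∑ i ∈ Finset.range r, A ^ i) * (∑ j ∈ Finset.range x, B ^ j) +
    A ^ r * (∑ j ∈ Finset.range x, B ^ j) * (∑ k ∈ Finset.range s, (A * B') ^ k) -
    A * B ^ (x - 1) * (∑ i ∈ Finset.range r, A ^ i) * (∑ k ∈ Finset.range s, (A * B') ^ k)
  have hF : toSeries (TT r s x) = HahnSeries.ofPowerSeries ℤ _ F := by
    simp only [TT, F, A, B, B', map_add, map_sub, map_mul, map_sum, map_pow, toSeries_va,
      toSeries_vb, toSeries_vbinv]
  have hc : PowerSeries.constantCoeff F =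
      ∑ j ∈ Finset.range x, (LaurentPolynomial.T 1 : LaurentPolynomial ℤ) ^ j := by
    simp [F, A, B, B', zero_pow_eq, hr.ne', hr]
  have hne : PowerSeries.constantCoeff F ≠ 0 := by
    intro h
    rw [hc] at h
    have h1 := congrArg (LaurentPolynomial.eval₂ (RingHom.id ℤ) 1) h
    simp only [map_sum, map_pow, LaurentPolynomial.eval₂_T, one_zpow, Units.val_one, one_pow,
      map_zero, Finset.sum_const, Finset.card_range, nsmul_eq_mul, mul_one] at h1
    omega
  rw [lowestEval_of_toSeries_eq hF hne, hc]
  simp [LaurentPolynomial.eval₂_T]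

theorem isUnit_single_s12 (h : ℤ × ℤ) (u : ℤˣ) :
    IsUnit (AddMonoidAlgebra.single h (u : ℤ) : LP) := by
  refine IsUnit.of_mul_eq_one (AddMonoidAlgebra.single (-h) ((u⁻¹ : ℤˣ) : ℤ)) ?_
  rw [AddMonoidAlgebra.single_mul_single, add_neg_cancel, Units.mul_inv]
  rfl

theorem barLP_single (h : ℤ × ℤ) (c : ℤ) :
    barLP (AddMonoidAlgebra.single h c) = AddMonoidAlgebra.single (-h) c := by
  simp [barLP]

/-- Multiplying the conjugate of the torsion by `a ^ (r + s - 1)` clears negative powers of `a`. -/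
theorem va_pow_mul_barLP_TT {r s x : ℕ} (hr : 0 < r) (hs : 0 < s) :
    va ^ (r + s - 1) * barLP (TT r s x) =
      va ^ s * (∑ i ∈ Finset.range r, va ^ i) * (∑ j ∈ Finset.range x, vbinv ^ j) +
      (∑ j ∈ Finset.range x, vbinv ^ j) *
        (∑ k ∈ Finset.range s, va ^ k * vb ^ (s - 1 - k)) -
      vbinv ^ (x - 1) * (∑ i ∈ Finset.range r, va ^ i) *
        (∑ k ∈ Finset.range s, va ^ k * vb ^ (s - 1 - k)) := by
  set c : LP := AddMonoidAlgebra.single (-1, 0) 1 with hc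
  have hva : barLP va = c := by simp [va, barLP_single, hc]
  have hvb : barLP vb = vbinv := by simp [vb, vbinv, barLP_single]
  have hvbinv : barLP vbinv = vb := by simp [vb, vbinv, barLP_single]
  have hac : va * c = 1 := by
    rw [va, hc, AddMonoidAlgebra.single_mul_single]; rfl
  have hr' : va ^ (r - 1) * ∑ i ∈ Finset.range r, c ^ i = ∑ i ∈ Finset.range r, va ^ i := by
    rw [← Finset.sum_range_reflect, Finset.mul_sum]
    refine Finset.sum_congr rfl fun i hi => ?_
    rw [Finset.mem_range] at hi
    obtain ⟨m, hm⟩ : ∃ m, r - 1 = m + i := ⟨r - 1 - i, by omega⟩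
    rw [hm, Nat.add_sub_cancel, pow_add, mul_right_comm, ← mul_pow, hac, one_pow, one_mul]
  have hs' : va ^ (s - 1) * ∑ k ∈ Finset.range s, (c * vb) ^ k =
      ∑ k ∈ Finset.range s, va ^ k * vb ^ (s - 1 - k) := by
    rw [← Finset.sum_range_reflect, Finset.mul_sum]
    refine Finset.sum_congr rfl fun k hk => ?_
    rw [Finset.mem_range] at hk
    obtain ⟨m, hm⟩ : ∃ m, s - 1 = m + k := ⟨s - 1 - k, by omega⟩
    rw [hm, Nat.add_sub_cancel, pow_add, mul_pow, ← mul_assoc, mul_right_comm _ _ (c ^ m),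
      ← mul_pow, hac, one_pow, one_mul]
  obtain ⟨r, rfl⟩ := Nat.exists_eq_succ_of_ne_zero hr.ne'
  obtain ⟨s, rfl⟩ := Nat.exists_eq_succ_of_ne_zero hs.ne'
  simp only [TT, map_add, map_sub, map_mul, map_sum, map_pow, hva, hvb, hvbinv]
  rw [← hr', ← hs']
  have h1 : va ^ (r + 1) * c ^ (r + 1) = 1 := by rw [← mul_pow, hac, one_pow]
  simp only [Nat.succ_eq_add_one, show r + 1 + (s + 1) - 1 = r + 1 + s by omega,
    Nat.add_sub_cancel] at h1 ⊢
  generalize (∑ i ∈ Finset.range (r + 1), c ^ i) = P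
  generalize (∑ i ∈ Finset.range (s + 1), (c * vb) ^ i) = Q
  generalize (∑ i ∈ Finset.range x, vbinv ^ i) = R
  linear_combination (va ^ s * R * Q) * h1 -
    (va ^ (r + s) * vbinv ^ (x - 1) * P * Q) * hac

theorem lowestEval_barLP_TT_ne_zero {r s x : ℕ} (hr : 0 < r) (hs : 0 < s) {z : ℂˣ}
    (hz : ∑ j ∈ Finset.range x, ((z⁻¹ : ℂˣ) : ℂ) ^ j = 0) :
    lowestEval z (barLP (TT r s x)) ≠ 0 := by
  let A : PowerSeries (LaurentPolynomial ℤ) := PowerSeries.X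
  let B : PowerSeries (LaurentPolynomial ℤ) := PowerSeries.C (LaurentPolynomial.T 1)
  let B' : PowerSeries (LaurentPolynomial ℤ) := PowerSeries.C (LaurentPolynomial.T (-1))
  let F := A ^ s * (∑ i ∈ Finset.range r, A ^ i) * (∑ j ∈ Finset.range x, B' ^ j) +
      (∑ j ∈ Finset.range x, B' ^ j) * (∑ k ∈ Finset.range s, A ^ k * B ^ (s - 1 - k)) -
      B' ^ (x - 1) * (∑ i ∈ Finset.range r, A ^ i) *
        (∑ k ∈ Finset.range s, A ^ k * B ^ (s - 1 - k))
  have hF : toSeries (va ^ (r + s - 1) * barLP (TT r s x)) =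
      HahnSeries.ofPowerSeries ℤ _ F := by
    rw [va_pow_mul_barLP_TT hr hs]
    simp only [F, A, B, B', map_add, map_sub, map_mul, map_sum, map_pow, toSeries_va,
      toSeries_vb, toSeries_vbinv]
  have hc : LaurentPolynomial.eval₂ (Int.castRingHom ℂ) z (PowerSeries.constantCoeff F) =
      -((z⁻¹ : ℂˣ) : ℂ) ^ (x - 1) * (z : ℂ) ^ (s - 1) := by
    have hz' : ∑ j ∈ Finset.range x, ((z : ℂ)⁻¹) ^ j = 0 := by simpa using hz
    simp [F, A, B, B', zero_pow_eq, hr, hs, hs.ne', LaurentPolynomial.eval₂_T, hz',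
      -LaurentPolynomial.T_pow, -inv_pow]
  have hc0 : LaurentPolynomial.eval₂ (Int.castRingHom ℂ) z (PowerSeries.constantCoeff F) ≠ 0 := by
    rw [hc]
    simp
  have hne : PowerSeries.constantCoeff F ≠ 0 := by
    intro h
    exact hc0 (by rw [h, map_zero])
  have h := lowestEval_of_toSeries_eq (z := z) hF hne
  rw [map_mul] at h
  intro h0
  rw [h0, mul_zero] at h
  exact hc0 h.symm

theorem exists_irreducible_dvd_of_map_eq_zero {M N : Type*} [CommMonoidWithZero M]
    [WfDvdMonoid M] [CommMonoidWithZero N] [NoZeroDivisors N] [Nontrivial N] (φ : M →*₀ N)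
    {m : M} (hm : m ≠ 0) (h : φ m = 0) : ∃ p, Irreducible p ∧ p ∣ m ∧ φ p = 0 := by
  obtain ⟨f, hf, u, rfl⟩ := WfDvdMonoid.exists_factors m hm
  have hu : φ u ≠ 0 := (u.isUnit.map φ).ne_zero
  rw [map_mul, map_multiset_prod] at h
  have h0 := Multiset.prod_eq_zero_iff.mp ((mul_eq_zero.mp h).resolve_right hu)
  obtain ⟨p, hp, hp0⟩ := Multiset.mem_map.mp h0
  exact ⟨p, hf p hp, (Multiset.dvd_prod hp).mul_right _, hp0⟩

/-- For a prime `q`, the torsion `T(r, s, -q)` has an asymmetric irreducible factor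
whose lowest coefficient in `a` vanishes at a primitive `q`-th root of unity. -/
theorem exists_asymmetric_factor {q r s : ℕ} (hq : q.Prime) (hr : 0 < r) (hs : 0 < s) {z : ℂˣ}
    (hz : IsPrimitiveRoot (z : ℂ) q) :
    ∃ p : LP, Irreducible p ∧ ¬ doteqLP p (barLP p) ∧ p ∣ TT r s q ∧ lowestEval z p = 0 := by
  have : IsNoetherianRing LP := Algebra.FiniteType.isNoetherianRing ℤ LP
  have hsum : ∑ j ∈ Finset.range q, ((z⁻¹ : ℂˣ) : ℂ) ^ j = 0 := by
    have := hz.inv.geom_sum_eq_zero hq.one_lt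
    simpa using this
  have hbar := lowestEval_barLP_TT_ne_zero (x := q) hr hs hsum
  have hT : TT r s q ≠ 0 := by
    intro h
    simp [h] at hbar
  have h0 : lowestEval z (TT r s q) = 0 := by
    rw [lowestEval_TT hr hq.pos, hz.geom_sum_eq_zero hq.one_lt]
  obtain ⟨p, hp, hdvd, hp0⟩ := exists_irreducible_dvd_of_map_eq_zero _ hT h0
  refine ⟨p, hp, ?_, hdvd, hp0⟩
  rintro ⟨u, h, e⟩
  have hu : lowestEval z (AddMonoidAlgebra.single h (u : ℤ)) ≠ 0 :=
    ((isUnit_single_s12 h u).map (lowestEval z)).ne_zero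
  have hpb : lowestEval z (barLP p) = 0 := by
    have := congrArg (lowestEval z) e
    rw [hp0, map_mul] at this
    exact (mul_eq_zero.mp this.symm).resolve_left hu
  obtain ⟨g, hg⟩ := hdvd
  apply hbar
  rw [hg, map_mul, map_mul, hpb, zero_mul]

/-- **Proposition 7.2.** There are sequences of integers `r_i, s_i > 0 > t_i = -x_i`
and irreducible `p_i ∈ ℤ[a^{±1},b^{±1}]` with `s_i² + 1 = (r_i+s_i)(t_i+s_i)`,
`p_i ≐̸ p̄_i`, and `p_i ∣ T(r_j,s_j,t_j)` iff `i = j`. -/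
theorem pretzel_torsion_asymmetric_factors :
    ∃ (r s x : ℕ → ℕ) (p : ℕ → LP),
      (∀ i, 0 < r i ∧ 0 < s i ∧ 0 < x i) ∧
      (∀ i, ((s i : ℤ)) ^ 2 + 1 = ((r i : ℤ) + (s i : ℤ)) * (-(x i : ℤ) + (s i : ℤ))) ∧
      (∀ i, Irreducible (p i)) ∧
      (∀ i, ¬ doteqLP (p i) (barLP (p i))) ∧
      (∀ i j, p i ∣ TT (r j) (s j) (x j) ↔ i = j) := by
  let q : ℕ → ℕ := Nat.nth Nat.Prime
  have hq : ∀ i, (q i).Prime := Nat.prime_nth_prime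
  have hroot : ∀ i, ∃ z : ℂˣ, IsPrimitiveRoot (z : ℂ) (q i) := fun i =>
    have h := Complex.isPrimitiveRoot_exp (q i) (hq i).ne_zero
    ⟨(h.isUnit (hq i).ne_zero).unit, h⟩
  choose z hz using hroot
  choose p hp hasym hdvd hp0 using fun i =>
    exists_asymmetric_factor (hq i) (r := q i ^ 2 + q i + 1) (s := q i + 1)
      (Nat.succ_pos _) (Nat.succ_pos _) (hz i)
  refine ⟨fun i => q i ^ 2 + q i + 1, fun i => q i + 1, q, p,
    fun i => ⟨Nat.succ_pos _, Nat.succ_pos _, (hq i).pos⟩, fun i => ?_, hp, hasym,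
    fun i j => ⟨fun h => ?_, by rintro rfl; exact hdvd i⟩⟩
  · push_cast
    ring
  · obtain ⟨g, hg⟩ := h
    have h0 : ∑ k ∈ Finset.range (q j), (z i : ℂ) ^ k = 0 := by
      rw [← lowestEval_TT (r := q j ^ 2 + q j + 1) (Nat.succ_pos _) (hq j).pos (q j + 1), hg,
        map_mul, hp0, zero_mul]
    have h1 : (z i : ℂ) ^ q j = 1 := by
      rw [← sub_eq_zero, ← geom_sum_mul, h0, zero_mul]
    exact Nat.nth_injective Nat.infinite_setOfPred_prime
      ((Nat.prime_dvd_prime_iff_eq (hq i) (hq j)).mp ((hz i).dvd_of_pow_eq_one _ h1))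
end
end
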